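/- Let N,k ≥ 1 be integers, 0 ≤ γ < 1, and p1, p2 > 1 with p1 γ ≤ 1. Let u0 ∈ C₀(ℝ^{N+k}) with u0 ≥ 0 and u0 ≢ 0. Then the equation u_t − Δ_G u = ∫_0^t (t−s)^{−γ} |u(s)|^{p1−1}u(s) ds + |u(t)|^{p2−1}u(t) with initial datum u(·,0) = u0 admits no global nonnegative weak solution u belonging to C([0,∞), C₀(ℝ^{N+k})). -/

import Mathlib

open MeasureTheory Real Filter
open scoped ENNReal NNReal

noncomputable section

abbrev Euc (n : ℕ) : Type := EuclideanSpace ℝ (Fin n)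

/-- Second derivative of `f` at `z`, taken twice in the direction `v`. -/
def secondDeriv {N k : ℕ} (f : Euc N × Euc k → ℝ) (z v : Euc N × Euc k) : ℝ :=
  fderiv ℝ (fun w => fderiv ℝ f w v) z v

/-- The Laplacian in the `x`-variables. -/
def laplacianX {N k : ℕ} (f : Euc N × Euc k → ℝ) (z : Euc N × Euc k) : ℝ :=
  ∑ i : Fin N, secondDeriv f z (EuclideanSpace.single i 1, 0)

/-- The Laplacian in the `y`-variables. -/
def laplacianY {N k : ℕ} (f : Euc N × Euc k → ℝ) (z : Euc N × Euc k) : ℝ :=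
  ∑ j : Fin k, secondDeriv f z (0, EuclideanSpace.single j 1)

/-- The Grushin operator `Δ_G = Δ_x + |x|² Δ_y`. -/
def grushin {N k : ℕ} (f : Euc N × Euc k → ℝ) (z : Euc N × Euc k) : ℝ :=
  laplacianX f z + ‖z.1‖ ^ 2 * laplacianY f z

/-- The power nonlinearity `|v|^(p-1) · v`. -/
def absPow (p v : ℝ) : ℝ := |v| ^ (p - 1) * v

/-- The Riemann–Liouville fractional integral `I^α_{0|t} f`. -/
def fracInt (α : ℝ) (f : ℝ → ℝ) (t : ℝ) : ℝ :=
  (1 / Real.Gamma α) * ∫ s in Set.Ioc (0 : ℝ) t, (t - s) ^ (α - 1) * f s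


/-- Weak solution on `ℝ^{N+k} × [0,T]` of
`u_t − Δ_G u = k1 ∫_0^t (t−s)^{−γ}|u(s)|^{p1−1}u(s) ds + k2 |u|^{p2−1}u`, `u(·,0) = u0`
(with `α = 1 − γ`). -/
def IsWeakSolutionGen (N k : ℕ) (k1 k2 γ p1 p2 T : ℝ) (u0 : Euc N × Euc k → ℝ)
    (u : Euc N × Euc k → ℝ → ℝ) : Prop :=
  LocallyIntegrableOn
      (fun q : (Euc N × Euc k) × ℝ => fracInt (1 - γ) (fun s => absPow p1 (u q.1 s)) q.2)
      (Set.univ ×ˢ Set.Ioo 0 T) volume ∧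
  LocallyIntegrableOn (fun q : (Euc N × Euc k) × ℝ => absPow p2 (u q.1 q.2))
      (Set.univ ×ˢ Set.Ioo 0 T) volume ∧
  ∀ φ : Euc N × Euc k → ℝ → ℝ,
    ContDiff ℝ 2 (fun q : (Euc N × Euc k) × ℝ => φ q.1 q.2) →
    HasCompactSupport (fun q : (Euc N × Euc k) × ℝ => φ q.1 q.2) →
    (∀ z, φ z T = 0) →
    ((∫ z, u z T * φ z T) - ∫ z, u0 z * φ z 0) =
      k1 * Real.Gamma (1 - γ) *
        (∫ t in Set.Ioc (0 : ℝ) T, ∫ z,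
          fracInt (1 - γ) (fun s => absPow p1 (u z s)) t * φ z t) +
      k2 * (∫ t in Set.Ioc (0 : ℝ) T, ∫ z, absPow p2 (u z t) * φ z t) +
      (∫ t in Set.Ioc (0 : ℝ) T, ∫ z, u z t * grushin (fun w => φ w t) z) +
      (∫ t in Set.Ioc (0 : ℝ) T, ∫ z, u z t * deriv (φ z) t)


/-- cubic positive part -/
def m3 (s : ℝ) : ℝ := (max 0 s) ^ 3

lemma hasDerivAt_m3 (s : ℝ) : HasDerivAt m3 (3 * (max 0 s) ^ 2) s := by
  rcases lt_trichotomy s 0 with h | h | h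
  · have h1 : m3 =ᶠ[nhds s] fun _ => 0 := by
      filter_upwards [gt_mem_nhds h] with y hy
      simp [m3, max_eq_left hy.le]
    rw [max_eq_left h.le]
    simpa using (hasDerivAt_const s (0 : ℝ)).congr_of_eventuallyEq h1
  · subst h
    rw [hasDerivAt_iff_isLittleO_nhds_zero]
    simp only [m3, zero_add, max_self]
    have : (fun h : ℝ => (max 0 h) ^ 3 - 0 ^ 3 - h • (3 * (0 : ℝ) ^ 2)) =O[nhds 0] fun h => h ^ 3 := by
      apply Asymptotics.IsBigO.of_bound 1
      filter_upwards with h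
      simp only [norm_eq_abs]
      rcases le_total h 0 with hh | hh
      · simp [max_eq_left hh]
      · simp [max_eq_right hh]
    refine this.trans_isLittleO ?_
    simpa using (Asymptotics.isLittleO_pow_id (𝕜 := ℝ) (n := 3) (by norm_num))
  · have h1 : m3 =ᶠ[nhds s] fun y => y ^ 3 := by
      filter_upwards [lt_mem_nhds h] with y hy
      simp [m3, max_eq_right hy.le]
    rw [max_eq_right h.le]
    simpa using (hasDerivAt_pow 3 s).congr_of_eventuallyEq h1

lemma hasDerivAt_m2 (s : ℝ) : HasDerivAt (fun s : ℝ => (max 0 s) ^ 2) (2 * max 0 s) s := by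
  rcases lt_trichotomy s 0 with h | h | h
  · have h1 : (fun s : ℝ => (max 0 s) ^ 2) =ᶠ[nhds s] fun _ => 0 := by
      filter_upwards [gt_mem_nhds h] with y hy
      simp [max_eq_left hy.le]
    rw [max_eq_left h.le]
    simpa using (hasDerivAt_const s (0 : ℝ)).congr_of_eventuallyEq h1
  · subst h
    rw [hasDerivAt_iff_isLittleO_nhds_zero]
    simp only [zero_add, max_self]
    have : (fun h : ℝ => (max 0 h) ^ 2 - 0 ^ 2 - h • (2 * (0 : ℝ))) =O[nhds 0] fun h => h ^ 2 := by
      apply Asymptotics.IsBigO.of_bound 1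
      filter_upwards with h
      simp only [norm_eq_abs]
      rcases le_total h 0 with hh | hh
      · simp [max_eq_left hh]; positivity
      · simp [max_eq_right hh]
    refine this.trans_isLittleO ?_
    simpa using (Asymptotics.isLittleO_pow_id (𝕜 := ℝ) (n := 2) (by norm_num))
  · have h1 : (fun s : ℝ => (max 0 s) ^ 2) =ᶠ[nhds s] fun y => y ^ 2 := by
      filter_upwards [lt_mem_nhds h] with y hy
      simp [max_eq_right hy.le]
    rw [max_eq_right h.le]
    simpa using (hasDerivAt_pow 2 s).congr_of_eventuallyEq h1

lemma contDiff_m3 : ContDiff ℝ 2 m3 := by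
  have e1 : deriv m3 = fun s => 3 * (max 0 s) ^ 2 := funext fun s => (hasDerivAt_m3 s).deriv
  have e2 : deriv (fun s : ℝ => 3 * (max 0 s) ^ 2) = fun s => 3 * (2 * max 0 s) :=
    funext fun s => ((hasDerivAt_m2 s).const_mul 3).deriv
  have : (2 : WithTop ℕ∞) = 1 + 1 := by norm_num
  rw [this, contDiff_succ_iff_deriv]
  refine ⟨fun s => (hasDerivAt_m3 s).differentiableAt, by simp, ?_⟩
  rw [e1]
  have : (1 : WithTop ℕ∞) = 0 + 1 := by norm_num
  rw [this, contDiff_succ_iff_deriv]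
  refine ⟨fun s => ((hasDerivAt_m2 s).const_mul 3).differentiableAt, by simp, ?_⟩
  rw [e2, contDiff_zero]
  fun_prop

lemma m3_nonneg (s : ℝ) : 0 ≤ m3 s := by unfold m3; positivity

lemma m3_zero {s : ℝ} (h : s ≤ 0) : m3 s = 0 := by simp [m3, max_eq_left h]

lemma m3_pos {s : ℝ} (h : 0 < s) : 0 < m3 s := by
  rw [m3, max_eq_right h.le]; positivity

/-- the spatial test function -/
def psi {N k : ℕ} (z₀ : Euc N × Euc k) (z : Euc N × Euc k) : ℝ :=
  m3 (1 - ‖z.1 - z₀.1‖ ^ 2) * m3 (1 - ‖z.2 - z₀.2‖ ^ 2)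

/-- its first derivative -/
def dpsi {N k : ℕ} (z₀ z v : Euc N × Euc k) : ℝ :=
  (3 * (max 0 (1 - ‖z.1 - z₀.1‖ ^ 2)) ^ 2 * (-(2 * inner ℝ (z.1 - z₀.1) v.1))) *
    m3 (1 - ‖z.2 - z₀.2‖ ^ 2) +
  m3 (1 - ‖z.1 - z₀.1‖ ^ 2) * (3 * (max 0 (1 - ‖z.2 - z₀.2‖ ^ 2)) ^ 2 *
    (-(2 * inner ℝ (z.2 - z₀.2) v.2)))

section
variable {N k : ℕ} (z₀ z v : Euc N × Euc k)

lemma hasD_line (f : Euc N × Euc k → ℝ) (hf : DifferentiableAt ℝ f z) (c : ℝ)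
    (h : HasDerivAt (fun t : ℝ => f (z + t • v)) c 0) : fderiv ℝ f z v = c := by
  have h2 : HasLineDerivAt ℝ f c z v := h
  rw [← hf.lineDeriv_eq_fderiv, h2.lineDeriv]

lemma contDiff_psi : ContDiff ℝ 2 (psi z₀) := by
  unfold psi
  apply ContDiff.mul <;> apply contDiff_m3.comp <;> apply contDiff_const.sub <;>
    apply ContDiff.norm_sq ℝ <;> fun_prop

lemma line_inner {n : ℕ} (a b : Euc n) :
    HasDerivAt (fun t : ℝ => 1 - ‖a + t • b‖ ^ 2) (-(2 * inner ℝ a b)) 0 := by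
  have h1 : HasDerivAt (fun t : ℝ => a + t • b) b 0 := by
    simpa using ((hasDerivAt_id (0 : ℝ)).smul_const b).const_add a
  have := h1.norm_sq.const_sub 1
  simpa using this

lemma fderiv_psi : fderiv ℝ (psi z₀) z v = dpsi z₀ z v := by
  apply hasD_line
  · exact (contDiff_psi z₀).differentiable (by norm_num) z
  have h1 := line_inner (z.1 - z₀.1) v.1
  have h2 := line_inner (z.2 - z₀.2) v.2
  have h3 : HasDerivAt (fun t : ℝ => m3 (1 - ‖z.1 - z₀.1 + t • v.1‖ ^ 2)) _ 0 :=
    HasDerivAt.comp (h₂ := m3) (0 : ℝ) (hasDerivAt_m3 _) h1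
  have h4 : HasDerivAt (fun t : ℝ => m3 (1 - ‖z.2 - z₀.2 + t • v.2‖ ^ 2)) _ 0 :=
    HasDerivAt.comp (h₂ := m3) (0 : ℝ) (hasDerivAt_m3 _) h2
  have := h3.mul h4
  simp only [zero_smul, add_zero] at this
  unfold dpsi
  refine this.congr_of_eventuallyEq (Eventually.of_forall fun t => ?_)
  simp [psi, add_sub_right_comm]

lemma second_x (e : Euc N) (he : ‖e‖ = 1) : secondDeriv (psi z₀) z (e, 0) =
    (24 * max 0 (1 - ‖z.1 - z₀.1‖ ^ 2) * inner ℝ (z.1 - z₀.1) e ^ 2 -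
      6 * (max 0 (1 - ‖z.1 - z₀.1‖ ^ 2)) ^ 2) * m3 (1 - ‖z.2 - z₀.2‖ ^ 2) := by
  unfold secondDeriv
  apply hasD_line
  · have h := (contDiff_psi z₀).fderiv_right (m := 1) (by norm_num)
    exact (h.differentiable (by norm_num) z).clm_apply (differentiableAt_const _)
  simp only [fderiv_psi]
  have h1 := line_inner (z.1 - z₀.1) e
  have h3 : HasDerivAt (fun t : ℝ => (max 0 (1 - ‖z.1 - z₀.1 + t • e‖ ^ 2)) ^ 2) _ 0 :=
    HasDerivAt.comp (h₂ := fun s : ℝ => (max 0 s) ^ 2) (0 : ℝ) (hasDerivAt_m2 _) h1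
  have h4 : HasDerivAt (fun t : ℝ => -(2 * (inner ℝ (z.1 - z₀.1) e + t * 1))) (-(2 * 1)) 0 := by
    have := ((((hasDerivAt_id (0 : ℝ)).mul_const 1).const_add
      (inner ℝ (z.1 - z₀.1) e : ℝ)).const_mul 2).fun_neg
    simpa using this
  have := ((h3.const_mul 3).fun_mul h4).mul_const (m3 (1 - ‖z.2 - z₀.2‖ ^ 2))
  simp only [zero_smul, add_zero, zero_mul] at this
  refine HasDerivAt.congr_deriv
    (this.congr_of_eventuallyEq (Eventually.of_forall fun t => ?_)) (by ring)
  · simp [dpsi, add_sub_right_comm, inner_add_left, inner_smul_left, he]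

lemma second_y (e : Euc k) (he : ‖e‖ = 1) : secondDeriv (psi z₀) z (0, e) =
    (24 * max 0 (1 - ‖z.2 - z₀.2‖ ^ 2) * inner ℝ (z.2 - z₀.2) e ^ 2 -
      6 * (max 0 (1 - ‖z.2 - z₀.2‖ ^ 2)) ^ 2) * m3 (1 - ‖z.1 - z₀.1‖ ^ 2) := by
  unfold secondDeriv
  apply hasD_line
  · have h := (contDiff_psi z₀).fderiv_right (m := 1) (by norm_num)
    exact (h.differentiable (by norm_num) z).clm_apply (differentiableAt_const _)
  simp only [fderiv_psi]
  have h1 := line_inner (z.2 - z₀.2) e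
  have h3 : HasDerivAt (fun t : ℝ => (max 0 (1 - ‖z.2 - z₀.2 + t • e‖ ^ 2)) ^ 2) _ 0 :=
    HasDerivAt.comp (h₂ := fun s : ℝ => (max 0 s) ^ 2) (0 : ℝ) (hasDerivAt_m2 _) h1
  have h4 : HasDerivAt (fun t : ℝ => -(2 * (inner ℝ (z.2 - z₀.2) e + t * 1))) (-(2 * 1)) 0 := by
    have := ((((hasDerivAt_id (0 : ℝ)).mul_const 1).const_add
      (inner ℝ (z.2 - z₀.2) e : ℝ)).const_mul 2).fun_neg
    simpa using this
  have := ((h3.const_mul 3).fun_mul h4).mul_const (m3 (1 - ‖z.1 - z₀.1‖ ^ 2))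
  simp only [zero_smul, add_zero, zero_mul] at this
  refine HasDerivAt.congr_deriv
    (this.congr_of_eventuallyEq (Eventually.of_forall fun t => ?_)) (by ring)
  · simp [dpsi, add_sub_right_comm, inner_add_left, inner_smul_left, he]
    ring

lemma sum_second {n : ℕ} (a : Euc n) (A B C : ℝ) :
    ∑ i : Fin n, (A * inner ℝ a (EuclideanSpace.single i (1 : ℝ)) ^ 2 - B) * C =
      (A * ‖a‖ ^ 2 - n * B) * C := by
  rw [← Finset.sum_mul, Finset.sum_sub_distrib, ← Finset.mul_sum, EuclideanSpace.real_norm_sq_eq]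
  simp [EuclideanSpace.inner_single_right]

/-- explicit Grushin of psi -/
def gpsi (z₀ z : Euc N × Euc k) : ℝ :=
  (24 * max 0 (1 - ‖z.1 - z₀.1‖ ^ 2) * ‖z.1 - z₀.1‖ ^ 2 -
      N * (6 * (max 0 (1 - ‖z.1 - z₀.1‖ ^ 2)) ^ 2)) * m3 (1 - ‖z.2 - z₀.2‖ ^ 2) +
  ‖z.1‖ ^ 2 * ((24 * max 0 (1 - ‖z.2 - z₀.2‖ ^ 2) * ‖z.2 - z₀.2‖ ^ 2 -
      k * (6 * (max 0 (1 - ‖z.2 - z₀.2‖ ^ 2)) ^ 2)) * m3 (1 - ‖z.1 - z₀.1‖ ^ 2))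

lemma grushin_psi : grushin (psi z₀) z = gpsi z₀ z := by
  unfold grushin laplacianX laplacianY gpsi
  rw [← sum_second, ← sum_second]
  congr 1
  · exact Finset.sum_congr rfl fun i _ => second_x _ _ _ (by simp)
  · congr 1
    exact Finset.sum_congr rfl fun i _ => second_y _ _ _ (by simp)

lemma poly_bound (n : ℕ) (q : ℝ) :
    -((24 + 6 * (n : ℝ)) ^ 2 / 96) * m3 (1 - q) ≤
      24 * max 0 (1 - q) * q - n * (6 * (max 0 (1 - q)) ^ 2) := by
  rcases le_total (1 - q) 0 with h | h
  · simp [m3, max_eq_left h]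
  · rw [m3, max_eq_right h]
    set m := 1 - q with hm
    have : q = 1 - m := by rw [hm]; ring
    rw [this]
    have := mul_nonneg h (sq_nonneg (48 - (24 + 6 * (n : ℝ)) * m))
    nlinarith

lemma poly_bound2 (n : ℕ) : ∃ l : ℝ, 0 ≤ l ∧ ∀ q : ℝ, -l * m3 (1 - q) ≤
      24 * max 0 (1 - q) * q - n * (6 * (max 0 (1 - q)) ^ 2) :=
  ⟨_, by positivity, poly_bound n⟩

lemma gpsi_bound : ∃ l : ℝ, 0 ≤ l ∧ ∀ z, -l * psi z₀ z ≤ gpsi z₀ z := by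
  obtain ⟨l1, hl1, pb1⟩ := poly_bound2 N
  obtain ⟨l2, hl2, pb2⟩ := poly_bound2 k
  refine ⟨l1 + (‖z₀.1‖ + 1) ^ 2 * l2, by positivity, fun z => ?_⟩
  have h1 := mul_le_mul_of_nonneg_right (pb1 (‖z.1 - z₀.1‖ ^ 2))
    (m3_nonneg (1 - ‖z.2 - z₀.2‖ ^ 2))
  have h2 := mul_le_mul_of_nonneg_right (pb2 (‖z.2 - z₀.2‖ ^ 2))
    (m3_nonneg (1 - ‖z.1 - z₀.1‖ ^ 2))
  have h3 := mul_le_mul_of_nonneg_left h2 (sq_nonneg ‖z.1‖)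
  have h4 : ‖z.1‖ ^ 2 * psi z₀ z ≤ (‖z₀.1‖ + 1) ^ 2 * psi z₀ z := by
    rcases le_or_gt (1 - ‖z.1 - z₀.1‖ ^ 2) 0 with h | h
    · simp [psi, m3_zero h]
    · have h5 : ‖z.1 - z₀.1‖ ≤ 1 := by
        by_contra hc
        push Not at hc
        nlinarith
      have h6 : ‖z.1‖ ≤ ‖z₀.1‖ + 1 := by
        have := norm_add_le (z.1 - z₀.1) z₀.1
        rw [sub_add_cancel] at this
        linarith
      have : 0 ≤ psi z₀ z := mul_nonneg (m3_nonneg _) (m3_nonneg _)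
      gcongr
  have h5 := mul_le_mul_of_nonneg_left h4 hl2
  unfold gpsi
  unfold psi at *
  linarith

/-- compact set carrying psi -/
def Kset (z₀ : Euc N × Euc k) : Set (Euc N × Euc k) :=
  Metric.closedBall z₀.1 1 ×ˢ Metric.closedBall z₀.2 1

lemma isCompact_Kset : IsCompact (Kset z₀) :=
  (isCompact_closedBall _ _).prod (isCompact_closedBall _ _)

lemma not_mem_K (h : z ∉ Kset z₀) :
    1 - ‖z.1 - z₀.1‖ ^ 2 ≤ 0 ∨ 1 - ‖z.2 - z₀.2‖ ^ 2 ≤ 0 := by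
  by_contra hc
  push Not at hc
  apply h
  simp only [Kset, Set.mem_prod, Metric.mem_closedBall, dist_eq_norm]
  constructor <;> nlinarith [norm_nonneg (z.1 - z₀.1), norm_nonneg (z.2 - z₀.2)]

lemma psi_zero (h : z ∉ Kset z₀) : psi z₀ z = 0 := by
  rcases not_mem_K z₀ z h with h | h <;> simp [psi, m3_zero h]

lemma gpsi_zero (h : z ∉ Kset z₀) : gpsi z₀ z = 0 := by
  rcases not_mem_K z₀ z h with h | h <;> simp [gpsi, m3_zero h, max_eq_left h]

lemma psi_nonneg : 0 ≤ psi z₀ z := mul_nonneg (m3_nonneg _) (m3_nonneg _)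

lemma continuous_gpsi : Continuous (gpsi z₀) := by
  have := contDiff_m3.continuous
  unfold gpsi
  fun_prop

lemma psi_self : psi z₀ z₀ = 1 := by simp [psi, m3]

lemma grushin_mul (f : Euc N × Euc k → ℝ) (hf : ContDiff ℝ 2 f) (c : ℝ) :
    grushin (fun w => f w * c) z = grushin f z * c := by
  have hs : ∀ v, secondDeriv (fun w => f w * c) z v = secondDeriv f z v * c := by
    intro v
    unfold secondDeriv
    have h1 : ∀ w, fderiv ℝ (fun w => f w * c) w v = fderiv ℝ f w v * c := by
      intro w
      rw [fderiv_mul_const (hf.differentiable (by norm_num) w)]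
      simp [mul_comm]
    simp only [h1]
    have h := hf.fderiv_right (m := 1) (by norm_num)
    rw [fderiv_mul_const ((h.differentiable (by norm_num) z).clm_apply (differentiableAt_const _))]
    simp [mul_comm]
  unfold grushin laplacianX laplacianY
  simp only [hs, ← Finset.sum_mul]
  ring

end

section
variable {N k : ℕ}

lemma integ_prod (K : Set (Euc N × Euc k)) (hK : IsCompact K) (f : (Euc N × Euc k) × ℝ → ℝ)
    (hf : Continuous f) (h0 : ∀ z, z ∉ K → ∀ t, f (z, t) = 0) (a b : ℝ) :
    Integrable f ((volume : Measure (Euc N × Euc k)).prod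
      ((volume : Measure ℝ).restrict (Set.Ioc a b))) := by
  have h1 : IntegrableOn f (K ×ˢ Set.Icc a b) volume :=
    hf.continuousOn.integrableOn_compact (hK.prod isCompact_Icc)
  have h2 : IntegrableOn f (Set.univ ×ˢ Set.Ioc a b) volume := by
    refine h1.of_forall_sdiff_eq_zero (MeasurableSet.univ.prod measurableSet_Ioc) ?_
    rintro ⟨z, t⟩ ⟨⟨-, ht⟩, hn⟩
    apply h0
    intro hz
    exact hn ⟨hz, Set.Ioc_subset_Icc_self ht⟩
  have h3 := Measure.prod_restrict (μ := (volume : Measure (Euc N × Euc k)))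
    (ν := (volume : Measure ℝ)) Set.univ (Set.Ioc a b)
  rw [Measure.restrict_univ] at h3
  rw [h3]
  exact h2

lemma integ_slice (K : Set (Euc N × Euc k)) (hK : IsCompact K) (f : (Euc N × Euc k) → ℝ)
    (hf : Continuous f) (h0 : ∀ z, z ∉ K → f z = 0) : Integrable f volume :=
  hf.integrable_of_hasCompactSupport (HasCompactSupport.intro hK h0)

lemma continuous_absPow {p : ℝ} (hp : 1 < p) : Continuous (absPow p) := by
  unfold absPow
  exact (continuous_abs.rpow_const fun _ => Or.inr (by linarith)).mul continuous_id

lemma absPow_nonneg {p v : ℝ} (hv : 0 ≤ v) : 0 ≤ absPow p v := by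
  unfold absPow; positivity

lemma young {p v M : ℝ} (hp : 1 < p) (hv : 0 ≤ v) (hM : 0 < M) :
    v ≤ M ^ (1 - p) * absPow p v + M := by
  unfold absPow
  rw [abs_of_nonneg hv]
  rcases le_total v M with h | h
  · have : 0 ≤ M ^ (1 - p) * (v ^ (p - 1) * v) := by positivity
    linarith
  · have h1 : M ^ (p - 1) ≤ v ^ (p - 1) := rpow_le_rpow hM.le h (by linarith)
    have h2 : M ^ (1 - p) * M ^ (p - 1) = 1 := by rw [← rpow_add hM]; simp
    have h3 : 1 ≤ M ^ (1 - p) * v ^ (p - 1) := by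
      have := mul_le_mul_of_nonneg_left h1 (show 0 ≤ M ^ (1 - p) by positivity)
      linarith
    nlinarith

lemma continuous_psi (z₀ : Euc N × Euc k) : Continuous (psi z₀) := (contDiff_psi z₀).continuous

lemma int_add3 {α : Type*} [MeasurableSpace α] {μ : Measure α} {f g h : α → ℝ}
    (hf : Integrable f μ) (hg : Integrable g μ) (hh : Integrable h μ) :
    (∫ x, f x ∂μ) + (∫ x, g x ∂μ) + (∫ x, h x ∂μ) = ∫ x, (f x + g x + h x) ∂μ := by
  rw [integral_add (f := fun x => f x + g x) (hf.add hg) hh, integral_add hf hg]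

lemma weak_ineq (z₀ : Euc N × Euc k) (γ p1 p2 T : ℝ)
    (u0 : Euc N × Euc k → ℝ) (v : Euc N × Euc k → ℝ → ℝ)
    (hv : Continuous fun q : (Euc N × Euc k) × ℝ => v q.1 q.2) (hv0 : ∀ z t, 0 ≤ v z t)
    (hw : IsWeakSolutionGen N k 1 1 γ p1 p2 T u0 v) (η : ℝ → ℝ) (hη : ContDiff ℝ 2 η)
    (hηc : HasCompactSupport η) (hη0 : ∀ t, 0 ≤ η t) (hηT : η T = 0)
    (l : ℝ) (hl : ∀ z, -l * psi z₀ z ≤ gpsi z₀ z) :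
    (∫ z, u0 z * psi z₀ z) * η 0 + Real.Gamma (1 - γ) *
        (∫ t in Set.Ioc (0 : ℝ) T, ∫ z,
          fracInt (1 - γ) (fun s => absPow p1 (v z s)) t * (psi z₀ z * η t)) ≤
      ∫ t in Set.Ioc (0 : ℝ) T, ∫ z, v z t * psi z₀ z * (l * η t - deriv η t) := by
  have hid := hw.2.2 (fun z t => psi z₀ z * η t) ?_ ?_ ?_
  · have hψc := continuous_psi z₀
    have hgc := continuous_gpsi z₀
    have hηc' := hη.continuous
    have hdc : Continuous (deriv η) := hη.continuous_deriv (by norm_num)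
    have hK := isCompact_Kset z₀
    have e1 : ∀ z t, grushin (fun w => psi z₀ w * η t) z = gpsi z₀ z * η t := fun z t => by
      rw [grushin_mul z (psi z₀) (contDiff_psi z₀), grushin_psi]
    have e2 : ∀ z t, deriv (fun s => psi z₀ z * η s) t = psi z₀ z * deriv η t := fun z t => by
      rw [deriv_const_mul _ ((hη.differentiable (by norm_num)) t)]
    simp only [e1, e2, hηT, mul_zero, integral_zero, one_mul] at hid
    have e3 : ∫ z, u0 z * (psi z₀ z * η 0) = (∫ z, u0 z * psi z₀ z) * η 0 := by
      rw [← integral_mul_const]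
      simp only [mul_assoc]
    rw [e3] at hid
    have hv' : ∀ t, Continuous fun z => v z t := fun t =>
      hv.comp (continuous_id.prodMk continuous_const)
    -- continuity facts on the product
    have c1 : Continuous fun q : (Euc N × Euc k) × ℝ => v q.1 q.2 * (gpsi z₀ q.1 * η q.2) := by
      fun_prop
    have c2 : Continuous fun q : (Euc N × Euc k) × ℝ => v q.1 q.2 * (psi z₀ q.1 * deriv η q.2) := by
      fun_prop
    have c3 : Continuous fun q : (Euc N × Euc k) × ℝ =>
        v q.1 q.2 * psi z₀ q.1 * (l * η q.2 - deriv η q.2) := by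
      fun_prop
    have i1 := (integ_prod _ hK _ c1 (fun z hz t => by simp [gpsi_zero z₀ z hz]) 0 T).integral_prod_right
    have i2 := (integ_prod _ hK _ c2 (fun z hz t => by simp [psi_zero z₀ z hz]) 0 T).integral_prod_right
    have i3 := (integ_prod _ hK _ c3 (fun z hz t => by simp [psi_zero z₀ z hz]) 0 T).integral_prod_right
    have hsource : 0 ≤ ∫ t in Set.Ioc (0 : ℝ) T, ∫ z, absPow p2 (v z t) * (psi z₀ z * η t) :=
      integral_nonneg fun t => integral_nonneg fun z =>
        mul_nonneg (absPow_nonneg (hv0 z t)) (mul_nonneg (psi_nonneg z₀ z) (hη0 t))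
    have hmain : 0 ≤ (∫ t in Set.Ioc (0 : ℝ) T, ∫ z, v z t * (gpsi z₀ z * η t)) +
        (∫ t in Set.Ioc (0 : ℝ) T, ∫ z, v z t * (psi z₀ z * deriv η t)) +
        ∫ t in Set.Ioc (0 : ℝ) T, ∫ z, v z t * psi z₀ z * (l * η t - deriv η t) := by
      refine le_of_le_of_eq ?_ (int_add3 i1 i2 i3).symm
      refine integral_nonneg fun t => ?_
      have j1 : Integrable fun z => v z t * (gpsi z₀ z * η t) :=
        integ_slice _ hK _ (by have := hv' t; fun_prop) (fun z hz => by simp [gpsi_zero z₀ z hz])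
      have j2 : Integrable fun z => v z t * (psi z₀ z * deriv η t) :=
        integ_slice _ hK _ (by have := hv' t; fun_prop) (fun z hz => by simp [psi_zero z₀ z hz])
      have j3 : Integrable fun z => v z t * psi z₀ z * (l * η t - deriv η t) :=
        integ_slice _ hK _ (by have := hv' t; fun_prop) (fun z hz => by simp [psi_zero z₀ z hz])
      have : (∫ z, v z t * (gpsi z₀ z * η t)) + (∫ z, v z t * (psi z₀ z * deriv η t)) +
          ∫ z, v z t * psi z₀ z * (l * η t - deriv η t) =
          ∫ z, (v z t * (gpsi z₀ z * η t) + v z t * (psi z₀ z * deriv η t) +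
            v z t * psi z₀ z * (l * η t - deriv η t)) := by
        exact int_add3 j1 j2 j3
      refine le_of_le_of_eq ?_ this.symm
      refine integral_nonneg fun z => ?_
      have h1 : 0 ≤ v z t * η t * (gpsi z₀ z + l * psi z₀ z) :=
        mul_nonneg (mul_nonneg (hv0 z t) (hη0 t)) (by linarith [hl z])
      simp only [Pi.zero_apply]
      linarith
    have : ∀ A B : ℝ, 0 - A = B → A = -B := fun A B h => by linarith
    linarith
  · have h1 := (contDiff_psi z₀).comp (contDiff_fst (E := Euc N × Euc k) (F := ℝ))
    have h2 := hη.comp (contDiff_snd (E := Euc N × Euc k) (F := ℝ))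
    exact h1.mul h2
  · refine HasCompactSupport.intro ((isCompact_Kset z₀).prod hηc) ?_
    rintro ⟨z, t⟩ hq
    simp only [Set.mem_prod, not_and_or] at hq
    rcases hq with h | h
    · simp [psi_zero z₀ z h]
    · simp [image_eq_zero_of_notMem_tsupport h]
  · intro z
    simp [hηT]

/-- The weighted mass of the nonlinearity. -/
def Qf (p : ℝ) (z₀ : Euc N × Euc k) (v : Euc N × Euc k → ℝ → ℝ) (s : ℝ) : ℝ :=
  ∫ z, absPow p (v z s) * psi z₀ z

lemma continuous_Qf (p : ℝ) (hp : 1 < p) (z₀ : Euc N × Euc k) (v : Euc N × Euc k → ℝ → ℝ)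
    (hv : Continuous fun q : (Euc N × Euc k) × ℝ => v q.1 q.2) : Continuous (Qf p z₀ v) := by
  have h : Qf p z₀ v = fun s => ∫ z in Kset z₀, absPow p (v z s) * psi z₀ z := by
    funext s
    rw [setIntegral_eq_integral_of_forall_compl_eq_zero]
    · rfl
    · intro z hz
      simp [psi_zero z₀ z hz]
  rw [h]
  refine continuous_parametric_integral_of_continuous
    (f := fun (s : ℝ) (z : Euc N × Euc k) => absPow p (v z s) * psi z₀ z) ?_ (isCompact_Kset z₀)
  have h1 := continuous_absPow hp
  have h2 := continuous_psi z₀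
  have h3 : Continuous fun x : ℝ × (Euc N × Euc k) => v x.2 x.1 :=
    hv.comp (continuous_snd.prodMk continuous_fst)
  exact (h1.comp h3).mul (h2.comp continuous_snd)

lemma Qf_nonneg (p : ℝ) (z₀ : Euc N × Euc k) (v : Euc N × Euc k → ℝ → ℝ)
    (hv0 : ∀ z t, 0 ≤ v z t) (s : ℝ) : 0 ≤ Qf p z₀ v s :=
  integral_nonneg fun z => mul_nonneg (absPow_nonneg (hv0 z s)) (psi_nonneg z₀ z)

lemma rhs_bound (z₀ : Euc N × Euc k) (p a b T D M : ℝ) (hp : 1 < p)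
    (v : Euc N × Euc k → ℝ → ℝ) (ha : 0 ≤ a) (hab : a ≤ b) (hbT : b ≤ T) (hD : 0 ≤ D) (hM : 0 < M)
    (hv : Continuous fun q : (Euc N × Euc k) × ℝ => v q.1 q.2) (hv0 : ∀ z t, 0 ≤ v z t)
    (ζ : ℝ → ℝ) (hζ : Continuous ζ) (h1 : ∀ t ∈ Set.Ioc a b, ζ t ≤ D)
    (h2 : ∀ t ∈ Set.Ioc 0 T, t ∉ Set.Ioc a b → ζ t ≤ 0) :
    ∫ t in Set.Ioc (0 : ℝ) T, ∫ z, v z t * psi z₀ z * ζ t ≤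
      D * (M ^ (1 - p) * (∫ s in a..b, Qf p z₀ v s) + M * (∫ z, psi z₀ z) * (b - a)) := by
  have hψc := continuous_psi z₀
  have hK := isCompact_Kset z₀
  have hQ := continuous_Qf p hp z₀ v hv
  have hv' : ∀ t, Continuous fun z => v z t := fun t =>
    hv.comp (continuous_id.prodMk continuous_const)
  have c3 : Continuous fun q : (Euc N × Euc k) × ℝ => v q.1 q.2 * psi z₀ q.1 * ζ q.2 := by
    fun_prop
  have i3 := (integ_prod _ hK _ c3 (fun z hz t => by simp [psi_zero z₀ z hz]) 0 T).integral_prod_right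
  set G : ℝ → ℝ := fun t => D * (M ^ (1 - p) * Qf p z₀ v t + M * ∫ z, psi z₀ z) with hG
  have hGc : Continuous G := by fun_prop
  have hsub : Set.Ioc a b ⊆ Set.Ioc 0 T := Set.Ioc_subset_Ioc ha hbT
  have step1 : ∫ t in Set.Ioc (0 : ℝ) T, ∫ z, v z t * psi z₀ z * ζ t ≤
      ∫ t in Set.Ioc (0 : ℝ) T, (Set.Ioc a b).indicator G t := by
    refine setIntegral_mono_on i3 ?_ measurableSet_Ioc ?_
    · have : IntegrableOn G (Set.Ioc 0 T) := hGc.integrableOn_Ioc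
      exact this.indicator measurableSet_Ioc
    · intro t ht
      rw [integral_mul_const]
      have hi : Integrable fun z => v z t * psi z₀ z :=
        integ_slice _ hK _ (by have := hv' t; fun_prop) (fun z hz => by simp [psi_zero z₀ z hz])
      have hi2 : Integrable fun z => absPow p (v z t) * psi z₀ z :=
        integ_slice _ hK _ (by have := hv' t; have := continuous_absPow hp; fun_prop)
          (fun z hz => by simp [psi_zero z₀ z hz])
      have hi3 : Integrable fun z => psi z₀ z :=
        integ_slice _ hK _ hψc (fun z hz => psi_zero z₀ z hz)
      have hF0 : 0 ≤ ∫ z, v z t * psi z₀ z :=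
        integral_nonneg fun z => mul_nonneg (hv0 z t) (psi_nonneg z₀ z)
      have hF : ∫ z, v z t * psi z₀ z ≤ M ^ (1 - p) * Qf p z₀ v t + M * ∫ z, psi z₀ z := by
        unfold Qf
        rw [← integral_const_mul, ← integral_const_mul,
          ← integral_add (hi2.const_mul _) (hi3.const_mul _)]
        refine integral_mono hi ((hi2.const_mul _).add (hi3.const_mul _)) fun z => ?_
        have := mul_le_mul_of_nonneg_right (young hp (hv0 z t) hM) (psi_nonneg z₀ z)
        linarith
      by_cases hab' : t ∈ Set.Ioc a b
      · rw [Set.indicator_of_mem hab', hG]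
        have := h1 t hab'
        calc _ ≤ (∫ z, v z t * psi z₀ z) * D := by gcongr
          _ ≤ (M ^ (1 - p) * Qf p z₀ v t + M * ∫ z, psi z₀ z) * D := by gcongr
          _ = _ := mul_comm _ _
      · rw [Set.indicator_of_notMem hab']
        exact mul_nonpos_of_nonneg_of_nonpos hF0 (h2 t ht hab')
  refine step1.trans (le_of_eq ?_)
  rw [setIntegral_indicator measurableSet_Ioc, Set.inter_eq_self_of_subset_right hsub,
    ← intervalIntegral.integral_of_le hab, hG]
  rw [intervalIntegral.integral_const_mul, intervalIntegral.integral_add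
    ((hQ.const_mul (M ^ (1 - p))).intervalIntegrable _ _) (by simp),
    intervalIntegral.integral_const_mul, intervalIntegral.integral_const]
  simp only [smul_eq_mul]
  ring

end

section
variable {N k : ℕ}

lemma frac_lower (w : ℝ → ℝ) (hw : Continuous w) (hw0 : ∀ s, 0 ≤ w s) (γ T t : ℝ)
    (hγ0 : 0 ≤ γ) (hγ1 : γ < 1) (hT : 0 < T) (ht : T ≤ t) (ht2 : t ≤ 2 * T) :
    (2 * T) ^ (-γ) * (∫ s in (0 : ℝ)..T, w s) ≤ Real.Gamma (1 - γ) * fracInt (1 - γ) w t := by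
  have hΓ : 0 < Real.Gamma (1 - γ) := Real.Gamma_pos_of_pos (by linarith)
  unfold fracInt
  rw [← mul_assoc, mul_one_div_cancel hΓ.ne', one_mul,
    ← intervalIntegral.integral_of_le (by linarith)]
  have hint : IntervalIntegrable (fun s => (t - s) ^ (1 - γ - 1) * w s) volume 0 t := by
    refine IntervalIntegrable.mul_continuousOn ?_ hw.continuousOn
    have := (intervalIntegral.intervalIntegrable_rpow' (a := t) (b := 0)
      (r := 1 - γ - 1) (by linarith)).comp_sub_left t
    simpa using this
  calc (2 * T) ^ (-γ) * (∫ s in (0 : ℝ)..T, w s)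
      ≤ (2 * T) ^ (-γ) * (∫ s in (0 : ℝ)..t, w s) := by
        gcongr
        refine intervalIntegral.integral_mono_interval le_rfl hT.le ht
          (Eventually.of_forall hw0) (hw.intervalIntegrable _ _)
    _ = ∫ s in (0 : ℝ)..t, (2 * T) ^ (-γ) * w s := by
        rw [intervalIntegral.integral_const_mul]
    _ ≤ _ := by
        refine intervalIntegral.integral_mono_on_of_le_Ioo (by linarith)
          ((hw.const_mul _).intervalIntegrable _ _) hint ?_
        intro s hs
        have h1 : 0 < t - s := by linarith [hs.2]
        have h2 : t - s ≤ 2 * T := by linarith [hs.1]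
        have h3 : (2 * T) ^ (-γ) ≤ (t - s) ^ (1 - γ - 1) := by
          rw [show 1 - γ - 1 = -γ by ring]
          exact rpow_le_rpow_of_nonpos h1 h2 (by linarith)
        exact mul_le_mul_of_nonneg_right h3 (hw0 s)

lemma lhs_bound (z₀ : Euc N × Euc k) (γ p T τ T' : ℝ) (hγ0 : 0 ≤ γ) (hγ1 : γ < 1) (hp : 1 < p)
    (v : Euc N × Euc k → ℝ → ℝ)
    (hv : Continuous fun q : (Euc N × Euc k) × ℝ => v q.1 q.2) (hv0 : ∀ z t, 0 ≤ v z t)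
    (hT : 0 < T) (hτ : 0 < τ) (hτT : τ ≤ T) (hT' : T + τ < T')
    (hloc : LocallyIntegrableOn
      (fun q : (Euc N × Euc k) × ℝ => fracInt (1 - γ) (fun s => absPow p (v q.1 s)) q.2)
      (Set.univ ×ˢ Set.Ioo 0 T') volume)
    (η : ℝ → ℝ) (hη : Continuous η) (hη0 : ∀ t, 0 ≤ η t)
    (hηz : ∀ t, t ∉ Set.Icc T (T + τ) → η t = 0) :
    (2 * T) ^ (-γ) * (∫ s in (0 : ℝ)..T, Qf p z₀ v s) * (∫ t, η t) ≤
      Real.Gamma (1 - γ) * (∫ t in Set.Ioc (0 : ℝ) T', ∫ z,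
          fracInt (1 - γ) (fun s => absPow p (v z s)) t * (psi z₀ z * η t)) := by
  have hψc := continuous_psi z₀
  have hK := isCompact_Kset z₀
  have hap := continuous_absPow hp
  have hv1 : ∀ z, Continuous fun t => v z t := fun z =>
    hv.comp (continuous_const.prodMk continuous_id)
  set W : Euc N × Euc k → ℝ := fun z => ∫ s in (0 : ℝ)..T, absPow p (v z s) with hW
  have hWc : Continuous W := by
    have : W = fun z => ∫ s in Set.Icc (0 : ℝ) T, absPow p (v z s) := by
      funext z
      rw [hW, integral_Icc_eq_integral_Ioc, ← intervalIntegral.integral_of_le hT.le]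
    rw [this]
    refine continuous_parametric_integral_of_continuous
      (f := fun (z : Euc N × Euc k) (s : ℝ) => absPow p (v z s)) ?_ isCompact_Icc
    exact hap.comp hv
  -- Fubini for W
  have hWS : ∫ z, W z * psi z₀ z = ∫ s in (0 : ℝ)..T, Qf p z₀ v s := by
    have c1 : Continuous fun q : (Euc N × Euc k) × ℝ => absPow p (v q.1 q.2) * psi z₀ q.1 := by
      fun_prop
    have i1 := integ_prod _ hK _ c1 (fun z hz t => by simp [psi_zero z₀ z hz]) 0 T
    have h1 := integral_integral_swap (f := fun z s => absPow p (v z s) * psi z₀ z) i1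
    rw [intervalIntegral.integral_of_le hT.le]
    unfold Qf
    rw [← h1]
    congr 1
    funext z
    rw [integral_mul_const]
    simp only [hW]
    rw [intervalIntegral.integral_of_le hT.le]
  -- product integrability of the memory term
  set g : (Euc N × Euc k) × ℝ → ℝ := fun q =>
    fracInt (1 - γ) (fun s => absPow p (v q.1 s)) q.2 * (psi z₀ q.1 * η q.2) with hg
  have hgi : Integrable g volume := by
    have hsub : Kset z₀ ×ˢ Set.Icc T (T + τ) ⊆ Set.univ ×ˢ Set.Ioo 0 T' := by
      rintro ⟨z, t⟩ ⟨-, h1, h2⟩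
      exact ⟨trivial, by linarith, by linarith⟩
    have hc : IsCompact (Kset z₀ ×ˢ Set.Icc T (T + τ)) := hK.prod isCompact_Icc
    have h1 := (hloc.integrableOn_compact_subset hsub hc).mul_continuousOn
      (g' := fun q : (Euc N × Euc k) × ℝ => psi z₀ q.1 * η q.2) (by fun_prop) hc
    refine (integrableOn_iff_integrable_of_support_subset ?_).1 h1
    rintro ⟨z, t⟩ hq
    by_contra hn
    apply hq
    simp only [Set.mem_prod, not_and_or] at hn
    show fracInt (1 - γ) (fun s => absPow p (v z s)) t * (psi z₀ z * η t) = 0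
    rcases hn with h | h
    · rw [psi_zero z₀ z h]; simp
    · rw [hηz t h]; simp
  have hswap : ∫ t in Set.Ioc (0 : ℝ) T', ∫ z,
      fracInt (1 - γ) (fun s => absPow p (v z s)) t * (psi z₀ z * η t) = ∫ q, g q := by
    have h1 : ∫ q, g q = ∫ t, ∫ z, g (z, t) := integral_prod_symm g hgi
    rw [h1, setIntegral_eq_integral_of_forall_compl_eq_zero]
    intro t ht
    have : η t = 0 := by
      apply hηz
      intro h
      exact ht ⟨by linarith [h.1], by linarith [h.2]⟩
    simp [this]
  rw [hswap, ← integral_const_mul (Real.Gamma (1 - γ)) g]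
  have hprod : (2 * T) ^ (-γ) * (∫ s in (0 : ℝ)..T, Qf p z₀ v s) * (∫ t, η t) =
      ∫ q : (Euc N × Euc k) × ℝ, ((2 * T) ^ (-γ) * (W q.1 * psi z₀ q.1)) * η q.2 := by
    rw [← hWS, ← integral_const_mul ((2 * T) ^ (-γ)) (fun z => W z * psi z₀ z)]
    exact (integral_prod_mul (μ := (volume : Measure (Euc N × Euc k)))
      (ν := (volume : Measure ℝ)) (fun z => (2 * T) ^ (-γ) * (W z * psi z₀ z)) η).symm
  rw [hprod]
  refine integral_mono ?_ (hgi.const_mul _) ?_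
  · refine Continuous.integrable_of_hasCompactSupport (by fun_prop)
      (HasCompactSupport.intro (hK.prod (isCompact_Icc (a := T) (b := T + τ))) ?_)
    rintro ⟨z, t⟩ hn
    simp only [Set.mem_prod, not_and_or] at hn
    rcases hn with h | h
    · simp [psi_zero z₀ z h]
    · simp [hηz t h]
  · rintro ⟨z, t⟩
    simp only [hg]
    by_cases ht : t ∈ Set.Icc T (T + τ)
    · have h1 := frac_lower (fun s => absPow p (v z s)) (hap.comp (hv1 z))
        (fun s => absPow_nonneg (hv0 z s)) γ T t hγ0 hγ1 hT ht.1 (by linarith [ht.2])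
      have h2 := mul_le_mul_of_nonneg_right h1 (mul_nonneg (psi_nonneg z₀ z) (hη0 t))
      simp only [hW]
      linarith
    · simp [hηz t ht]

/-- time bump -/
def bump (s : ℝ) : ℝ := m3 (s * (1 - s))

lemma bump_zero {s : ℝ} (h : s ∉ Set.Ioo (0 : ℝ) 1) : bump s = 0 := by
  apply m3_zero
  by_contra hc
  push Not at hc
  apply h
  constructor <;> nlinarith

lemma hasDerivAt_bump (s : ℝ) :
    HasDerivAt bump (3 * (max 0 (s * (1 - s))) ^ 2 * (1 - 2 * s)) s := by
  have h1 : HasDerivAt (fun s : ℝ => s * (1 - s)) (1 - 2 * s) s := by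
    have := (hasDerivAt_id s).fun_mul ((hasDerivAt_id s).const_sub 1)
    refine this.congr_deriv ?_
    simp
    ring
  exact HasDerivAt.comp (h₂ := m3) s (hasDerivAt_m3 _) h1

lemma contDiff_bump : ContDiff ℝ 2 bump := by
  unfold bump
  apply contDiff_m3.comp
  fun_prop

lemma bump_le (s : ℝ) : bump s ≤ 1 := by
  have h1 : max 0 (s * (1 - s)) ≤ 1 := max_le (by norm_num) (by nlinarith [sq_nonneg (s - 1)])
  exact pow_le_one₀ (le_max_left _ _) h1

lemma bump_integral_pos : 0 < ∫ s, bump s := by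
  refine Continuous.integral_pos_of_hasCompactSupport_nonneg_nonzero (x := 1 / 2)
    contDiff_bump.continuous (HasCompactSupport.intro (isCompact_Icc (a := (0 : ℝ)) (b := 1)) ?_)
    (fun s => m3_nonneg _) ?_
  · intro s hs
    exact bump_zero fun h => hs (Set.Ioo_subset_Icc_self h)
  · exact (m3_pos (by norm_num)).ne'

/-- everything together for a continuous nonnegative global solution -/
lemma key_ineq (z₀ : Euc N × Euc k) (γ p1 p2 : ℝ) (hγ0 : 0 ≤ γ) (hγ1 : γ < 1) (hp : 1 < p1)
    (u0 : Euc N × Euc k → ℝ)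
    (v : Euc N × Euc k → ℝ → ℝ)
    (hv : Continuous fun q : (Euc N × Euc k) × ℝ => v q.1 q.2) (hv0 : ∀ z t, 0 ≤ v z t)
    (hw : ∀ T : ℝ, 0 < T → IsWeakSolutionGen N k 1 1 γ p1 p2 T u0 v)
    (l : ℝ) (hl0 : 0 ≤ l) (hl : ∀ z, -l * psi z₀ z ≤ gpsi z₀ z) (T τ M : ℝ) (hT : 0 < T)
    (hτ : 0 < τ) (hτT : τ ≤ T) (hM : 0 < M) :
    (2 * T) ^ (-γ) * (∫ s in (0 : ℝ)..T, Qf p1 z₀ v s) * (τ * ∫ s, bump s) ≤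
      (l + 3 / τ) * (M ^ (1 - p1) * (∫ s in T..(T + τ), Qf p1 z₀ v s) +
        M * (∫ z, psi z₀ z) * τ) := by
  set η : ℝ → ℝ := fun t => bump ((t - T) / τ) with hη
  have hηC : ContDiff ℝ 2 η := contDiff_bump.comp (by fun_prop)
  have hη0 : ∀ t, 0 ≤ η t := fun t => m3_nonneg _
  have hout : ∀ t, t ∉ Set.Ioo T (T + τ) → (t - T) / τ ∉ Set.Ioo (0 : ℝ) 1 := by
    intro t ht h
    apply ht
    rw [Set.mem_Ioo, div_pos_iff_of_pos_right hτ, div_lt_one hτ] at h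
    exact ⟨by linarith [h.1], by linarith [h.2]⟩
  have hηz' : ∀ t, t ∉ Set.Ioo T (T + τ) → η t = 0 := fun t ht => bump_zero (hout t ht)
  have hηz : ∀ t, t ∉ Set.Icc T (T + τ) → η t = 0 := fun t ht =>
    hηz' t fun h => ht (Set.Ioo_subset_Icc_self h)
  have hd : ∀ t, deriv η t =
      3 * (max 0 ((t - T) / τ * (1 - (t - T) / τ))) ^ 2 * (1 - 2 * ((t - T) / τ)) * (1 / τ) := by
    intro t
    have h1 : HasDerivAt (fun t => (t - T) / τ) (1 / τ) t :=
      ((hasDerivAt_id t).sub_const T).div_const τ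
    exact (HasDerivAt.comp (h₂ := bump) t (hasDerivAt_bump _) h1).deriv
  have hηint : ∫ t, η t = τ * ∫ s, bump s := by
    rw [hη, integral_sub_right_eq_self (fun t => bump (t / τ)) T, Measure.integral_comp_div,
      abs_of_pos hτ, smul_eq_mul]
  have hT'0 : 0 < T + τ + 1 := by linarith
  have h1 := weak_ineq z₀ γ p1 p2 (T + τ + 1) u0 v hv hv0 (hw _ hT'0) η hηC
    (HasCompactSupport.intro isCompact_Icc hηz) hη0
    (hηz _ fun h => by linarith [h.2]) l hl
  rw [hηz 0 (fun h => by linarith [h.1]), mul_zero, zero_add] at h1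
  have h2 := lhs_bound z₀ γ p1 T τ (T + τ + 1) hγ0 hγ1 hp v hv hv0 hT hτ hτT (by linarith)
    (hw _ hT'0).1 η hηC.continuous hη0 hηz
  have h3 := rhs_bound z₀ p1 T (T + τ) (T + τ + 1) (l + 3 / τ) M hp v hT.le (by linarith)
    (by linarith) (by positivity) hM hv hv0 (fun t => l * η t - deriv η t)
    (by have := hηC.continuous_deriv (by norm_num); have := hηC.continuous; fun_prop) ?_ ?_
  · rw [hηint] at h2
    have := h2.trans (h1.trans h3)
    rwa [add_sub_cancel_left] at this
  · intro t ht
    have hs0 : 0 ≤ (t - T) / τ := div_nonneg (by linarith [ht.1]) hτ.le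
    have hs1 : (t - T) / τ ≤ 1 := by rw [div_le_one hτ]; linarith [ht.2]
    have e1 : l * η t ≤ l := by
      have := mul_le_mul_of_nonneg_left (bump_le ((t - T) / τ)) hl0
      simpa [hη] using this
    have e2 : -(3 / τ) ≤ deriv η t := by
      rw [hd]
      set s := (t - T) / τ with hs
      have h1 : max 0 (s * (1 - s)) ≤ 1 := max_le (by norm_num) (by nlinarith [sq_nonneg (s - 1)])
      have h2 : (max 0 (s * (1 - s))) ^ 2 ≤ 1 := pow_le_one₀ (le_max_left _ _) h1
      have h3 : 0 ≤ (max 0 (s * (1 - s))) ^ 2 := sq_nonneg _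
      have h4 : -3 ≤ 3 * (max 0 (s * (1 - s))) ^ 2 * (1 - 2 * s) := by nlinarith
      have h5 : 0 ≤ 1 / τ := by positivity
      have := mul_le_mul_of_nonneg_right h4 h5
      have e : -(3 / τ) = -3 * (1 / τ) := by ring
      rw [e]
      exact this
    linarith
  · intro t _ ht
    have ht' : t ∉ Set.Ioo T (T + τ) := fun h => ht (Set.Ioo_subset_Ioc_self h)
    have e : max 0 ((t - T) / τ * (1 - (t - T) / τ)) = 0 := by
      have : m3 ((t - T) / τ * (1 - (t - T) / τ)) = 0 := hηz' t ht'
      exact pow_eq_zero_iff (by norm_num) |>.1 this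
    have e3 : η t = 0 := hηz' t ht'
    have e4 : deriv η t = 0 := by rw [hd, e]; simp
    simp [e3, e4]

lemma start_pos (z₀ : Euc N × Euc k) (γ p1 p2 : ℝ) (hγ1 : γ < 1) (hp : 1 < p1)
    (u0 : Euc N × Euc k → ℝ) (hF0 : 0 < ∫ z, u0 z * psi z₀ z)
    (v : Euc N × Euc k → ℝ → ℝ)
    (hv : Continuous fun q : (Euc N × Euc k) × ℝ => v q.1 q.2) (hv0 : ∀ z t, 0 ≤ v z t)
    (hw : ∀ T : ℝ, 0 < T → IsWeakSolutionGen N k 1 1 γ p1 p2 T u0 v)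
    (l : ℝ) (hl0 : 0 ≤ l) (hl : ∀ z, -l * psi z₀ z ≤ gpsi z₀ z) :
    0 < ∫ s in (0 : ℝ)..2, Qf p1 z₀ v s := by
  by_contra hneg
  push Not at hneg
  set η : ℝ → ℝ := fun t => m3 (1 - t ^ 2) with hη
  have hηC : ContDiff ℝ 2 η := contDiff_m3.comp (by fun_prop)
  have hη0 : ∀ t, 0 ≤ η t := fun t => m3_nonneg _
  have hηz : ∀ t, t ∉ Set.Icc (-1 : ℝ) 1 → η t = 0 := by
    intro t ht
    apply m3_zero
    by_contra hc
    push Not at hc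
    exact ht ⟨by nlinarith, by nlinarith⟩
  have hd : ∀ t, deriv η t = 3 * (max 0 (1 - t ^ 2)) ^ 2 * (-(2 * t)) := by
    intro t
    have h1 : HasDerivAt (fun t : ℝ => 1 - t ^ 2) (-(2 * t)) t := by
      simpa using (hasDerivAt_pow 2 t).const_sub 1
    exact (HasDerivAt.comp (h₂ := m3) t (hasDerivAt_m3 _) h1).deriv
  have h1 := weak_ineq z₀ γ p1 p2 2 u0 v hv hv0 (hw _ (by norm_num)) η hηC
    (HasCompactSupport.intro isCompact_Icc hηz) hη0
    (hηz _ fun h => by linarith [h.2]) l hl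
  have hη1 : η 0 = 1 := by simp [hη, m3]
  have hΓ : 0 < Real.Gamma (1 - γ) := Real.Gamma_pos_of_pos (by linarith)
  have hA : 0 ≤ Real.Gamma (1 - γ) *
        (∫ t in Set.Ioc (0 : ℝ) 2, ∫ z,
          fracInt (1 - γ) (fun s => absPow p1 (v z s)) t * (psi z₀ z * η t)) := by
    refine mul_nonneg hΓ.le (integral_nonneg fun t => integral_nonneg fun z =>
      mul_nonneg ?_ (mul_nonneg (psi_nonneg _ _) (hη0 t)))
    unfold fracInt
    refine mul_nonneg (by positivity) (setIntegral_nonneg measurableSet_Ioc fun s hs => ?_)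
    exact mul_nonneg (rpow_nonneg (by linarith [hs.2]) _) (absPow_nonneg (hv0 z s))
  rw [hη1, mul_one] at h1
  have hψ0 : 0 ≤ ∫ z, psi z₀ z := integral_nonneg fun z => psi_nonneg z₀ z
  have hall : ∀ M : ℝ, 0 < M →
      (∫ z, u0 z * psi z₀ z) ≤ (l + 12) * (M * (∫ z, psi z₀ z) * 2) := by
    intro M hM
    have h3 := rhs_bound z₀ p1 0 2 2 (l + 12) M hp v le_rfl (by norm_num)
      le_rfl (by positivity) hM hv hv0 (fun t => l * η t - deriv η t)
      (by have := hηC.continuous_deriv (by norm_num); have := hηC.continuous; fun_prop) ?_ ?_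
    · have h4 : M ^ (1 - p1) * (∫ s in (0 : ℝ)..2, Qf p1 z₀ v s) ≤ 0 :=
        mul_nonpos_of_nonneg_of_nonpos (by positivity) hneg
      have h5 : (l + 12) * (M ^ (1 - p1) * (∫ s in (0 : ℝ)..2, Qf p1 z₀ v s) +
          M * (∫ z, psi z₀ z) * (2 - 0)) ≤ (l + 12) * (M * (∫ z, psi z₀ z) * 2) := by
        gcongr
        linarith
      linarith
    · intro t ht
      have h1 : max 0 (1 - t ^ 2) ≤ 1 := max_le (by norm_num) (by nlinarith [sq_nonneg t])
      have h2 : (max 0 (1 - t ^ 2)) ^ 2 ≤ 1 := pow_le_one₀ (le_max_left _ _) h1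
      have h3 : η t ≤ 1 := pow_le_one₀ (le_max_left _ _) h1
      have h4 : 0 ≤ (max 0 (1 - t ^ 2)) ^ 2 := sq_nonneg _
      have h5 : -12 ≤ deriv η t := by
        rw [hd]
        nlinarith [ht.1, ht.2]
      nlinarith
    · intro t ht hn
      exact absurd ht hn
  set F := ∫ z, u0 z * psi z₀ z
  set P := ∫ z, psi z₀ z
  have hc : 0 < 4 * ((l + 12) * (P + 1)) := by positivity
  have := hall (F / (4 * ((l + 12) * (P + 1)))) (by positivity)
  have e : (l + 12) * (F / (4 * ((l + 12) * (P + 1))) * P * 2) = F / 2 * (P / (P + 1)) := by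
    field_simp
    ring
  rw [e] at this
  have h6 : P / (P + 1) ≤ 1 := by rw [div_le_one (by linarith)]; linarith
  nlinarith

end

lemma ode_step (S : ℝ → ℝ) (γ p c C : ℝ) (hc : 0 < c) (hC : 0 < C)
    (hpγ : p * γ ≤ 1)
    (hkey : ∀ T τ M : ℝ, 1 ≤ T → 0 < τ → τ ≤ T → 0 < M →
      c * τ * T ^ (-γ) * S T ≤ C * (1 + 1 / τ) * (M ^ (1 - p) * (S (T + τ) - S T) + M * τ)) :
    ∀ T τ : ℝ, 1 ≤ T → 0 < τ → τ ≤ T → 0 < S T →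
      S T + (c / (2 * C)) ^ p * (τ * (1 + 1 / τ) ^ (-p)) * (S T) ^ p / T ≤ S (T + τ) := by
  intro T τ hT hτ hτT hS
  have hT0 : 0 < T := by linarith
  have hB : 0 < 1 + 1 / τ := by positivity
  set B := 1 + 1 / τ with hBdef
  set κ := c / (2 * C) with hκ
  have hκ0 : 0 < κ := by positivity
  have hTγ : 0 < T ^ (-γ) := by positivity
  set M := κ * T ^ (-γ) * S T / B with hM
  have hM0 : 0 < M := by positivity
  have h := hkey T τ M hT hτ hτT hM0
  have h1 : c * τ * T ^ (-γ) * S T = 2 * (C * B * (M * τ)) := by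
    rw [hM, hκ]; field_simp
  have h2 : C * B * (M * τ) ≤ C * B * (M ^ (1 - p) * (S (T + τ) - S T)) := by
    linarith [mul_add (C * B) (M ^ (1 - p) * (S (T + τ) - S T)) (M * τ)]
  have h3 : M * τ ≤ M ^ (1 - p) * (S (T + τ) - S T) := le_of_mul_le_mul_left h2 (by positivity)
  have h4 : M ^ p * τ ≤ S (T + τ) - S T := by
    have := mul_le_mul_of_nonneg_left h3 (show 0 ≤ M ^ (p - 1) by positivity)
    rw [← mul_assoc, ← mul_assoc, ← rpow_add hM0, ← rpow_add_one hM0.ne'] at this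
    simpa using this
  have h5 : M ^ p = κ ^ p * T ^ (-γ * p) * S T ^ p * B ^ (-p) := by
    rw [hM, div_rpow (by positivity) hB.le, mul_rpow (by positivity) hS.le,
      mul_rpow hκ0.le hTγ.le, ← rpow_mul hT0.le, rpow_neg hB.le, div_eq_mul_inv]
  have h6 : 1 / T ≤ T ^ (-γ * p) := by
    rw [one_div, ← rpow_neg_one]
    exact rpow_le_rpow_of_exponent_le hT (by linarith)
  have h7 : κ ^ p * (τ * B ^ (-p)) * (S T) ^ p / T ≤ M ^ p * τ := by
    rw [h5]
    calc _ = (κ ^ p * (τ * B ^ (-p)) * (S T) ^ p) * (1 / T) := by ring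
      _ ≤ (κ ^ p * (τ * B ^ (-p)) * (S T) ^ p) * T ^ (-γ * p) := by gcongr
      _ = _ := by ring
  linarith

lemma ode_blowup (S : ℝ → ℝ) (γ p c C : ℝ) (hc : 0 < c) (hC : 0 < C) (hp : 1 < p)
    (hpγ : p * γ ≤ 1) (hmono : ∀ s t, 0 ≤ s → s ≤ t → S s ≤ S t)
    (hpos : ∃ T, 0 ≤ T ∧ 0 < S T)
    (hkey : ∀ T τ M : ℝ, 1 ≤ T → 0 < τ → τ ≤ T → 0 < M →
      c * τ * T ^ (-γ) * S T ≤ C * (1 + 1 / τ) * (M ^ (1 - p) * (S (T + τ) - S T) + M * τ)) :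
    False := by
  have hstep := ode_step S γ p c C hc hC hpγ hkey
  set κ := (c / (2 * C)) ^ p with hκ
  have hκ0 : 0 < κ := by positivity
  set δ := κ * 2 ^ (-p) with hδ
  have hδ0 : 0 < δ := by positivity
  have hp0 : 0 < p - 1 := by linarith
  -- large steps
  have hI : ∀ T, 1 ≤ T → 0 < S T → S T + δ * S T ^ p ≤ S (2 * T) := by
    intro T hT hS
    have hT0 : 0 < T := by linarith
    have h := hstep T T hT hT0 le_rfl hS
    rw [← two_mul] at h
    refine le_trans ?_ h
    have h2 : (2 : ℝ) ^ (-p) ≤ (1 + 1 / T) ^ (-p) := by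
      apply rpow_le_rpow_of_nonpos (by positivity) _ (by linarith)
      have : 1 / T ≤ 1 := by rw [div_le_one hT0]; exact hT
      linarith
    have : κ * (T * (1 + 1 / T) ^ (-p)) * S T ^ p / T = κ * (1 + 1 / T) ^ (-p) * S T ^ p := by
      field_simp
    rw [this, hδ]
    gcongr
  -- small steps
  have hII : ∀ T τ, 1 ≤ T → 0 < τ → τ ≤ 1 → 0 < S T →
      S T + δ * τ ^ (1 + p) * S T ^ p / T ≤ S (T + τ) := by
    intro T τ hT hτ hτ1 hS
    refine le_trans ?_ (hstep T τ hT hτ (by linarith) hS)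
    have h2 : (2 : ℝ) ^ (-p) * τ ^ p ≤ (1 + 1 / τ) ^ (-p) := by
      have : (2 : ℝ) ^ (-p) * τ ^ p = (2 / τ) ^ (-p) := by
        rw [div_rpow (by norm_num) hτ.le, rpow_neg hτ.le p, div_inv_eq_mul]
      rw [this]
      apply rpow_le_rpow_of_nonpos (by positivity) _ (by linarith)
      have : 1 ≤ 1 / τ := by rw [le_div_iff₀ hτ]; linarith
      have h3 : 2 / τ = 1 / τ + 1 / τ := by ring
      linarith
    have h3 : τ ^ (1 + p) = τ * τ ^ p := by rw [rpow_add hτ, rpow_one]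
    have : 0 < T := by linarith
    rw [h3, hδ]
    have : κ * 2 ^ (-p) * (τ * τ ^ p) * S T ^ p / T = κ * (τ * (2 ^ (-p) * τ ^ p)) * S T ^ p / T := by
      ring
    rw [this]
    gcongr
  obtain ⟨T', hT'0, hT'⟩ := hpos
  set T0 := max T' 1 with hT0
  have hT01 : 1 ≤ T0 := le_max_right _ _
  set a : ℕ → ℝ := fun n => S (2 ^ n * T0) with ha
  have h2n : ∀ n : ℕ, 1 ≤ 2 ^ n * T0 := fun n => by
    have : (1 : ℝ) ≤ 2 ^ n := one_le_pow₀ (by norm_num)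
    nlinarith
  have ha0 : 0 < a 0 := by
    simp only [ha, pow_zero, one_mul]
    exact lt_of_lt_of_le hT' (hmono _ _ hT'0 (le_max_left _ _))
  have hage : ∀ n, a 0 ≤ a n := by
    intro n
    apply hmono _ _ (by linarith [h2n 0])
    have : (1 : ℝ) ≤ 2 ^ n := one_le_pow₀ (by norm_num)
    nlinarith
  have hapos : ∀ n, 0 < a n := fun n => ha0.trans_le (hage n)
  have hastep : ∀ n, a n + δ * a n ^ p ≤ a (n + 1) := by
    intro n
    have := hI _ (h2n n) (hapos n)
    simp only [ha, pow_succ]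
    convert this using 2
    ring
  have hlin : ∀ n : ℕ, n * (δ * a 0 ^ p) ≤ a n := by
    intro n
    induction n with
    | zero => simpa using ha0.le
    | succ n ih =>
      have h1 := hastep n
      have h2 : a 0 ^ p ≤ a n ^ p := rpow_le_rpow ha0.le (hage n) (by linarith)
      have h3 : δ * a 0 ^ p ≤ δ * a n ^ p := by gcongr
      push_cast
      linarith
  -- superlinear growth
  set L : ℝ := 4 ^ (1 / (p - 1)) with hL
  have hL0 : 0 < L := by positivity
  have hat : Tendsto a atTop atTop := by
    refine tendsto_atTop_mono hlin ?_
    exact tendsto_natCast_atTop_atTop.atTop_mul_const (by positivity)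
  have hat2 : Tendsto (fun n => a n ^ (p - 1)) atTop atTop :=
    (tendsto_rpow_atTop hp0).comp hat
  obtain ⟨n0, hn0⟩ := (tendsto_atTop.1 hat2 (L / δ)).exists_forall_of_atTop
  have hgeo : ∀ m : ℕ, L ^ m * a n0 ≤ a (n0 + m) := by
    intro m
    induction m with
    | zero => simp
    | succ m ih =>
      have h1 := hastep (n0 + m)
      have h2 := hn0 (n0 + m) (by omega)
      have hp' := hapos (n0 + m)
      have h3 : a (n0 + m) ^ p = a (n0 + m) ^ (p - 1) * a (n0 + m) := by
        rw [← rpow_add_one hp'.ne']; simp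
      rw [div_le_iff₀ hδ0] at h2
      have h4 : L * a (n0 + m) ≤ δ * a (n0 + m) ^ p := by
        rw [h3]; nlinarith
      have h5 : L * (L ^ m * a n0) ≤ L * a (n0 + m) := by gcongr
      rw [pow_succ, ← add_assoc]
      linarith
  have hgeo2 : ∀ m : ℕ, 4 ^ m * a n0 ^ (p - 1) ≤ a (n0 + m) ^ (p - 1) := by
    intro m
    have := rpow_le_rpow (mul_pos (pow_pos hL0 m) (hapos n0)).le (hgeo m) hp0.le
    rw [mul_rpow (by positivity) (hapos n0).le] at this
    have h4 : (L ^ m) ^ (p - 1) = 4 ^ m := by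
      have hLp : L ^ (p - 1) = 4 := by
        rw [hL, ← rpow_mul (by norm_num), one_div_mul_cancel hp0.ne', rpow_one]
      rw [← rpow_natCast, ← rpow_mul hL0.le, mul_comm, rpow_mul hL0.le, hLp, rpow_natCast]
    rwa [h4] at this
  -- find T with S(T)^(p-1) ≥ B T
  have hbig : ∀ B : ℝ, ∃ T, 1 ≤ T ∧ 0 < S T ∧ B * T ≤ S T ^ (p - 1) := by
    intro B
    have hA : 0 < a n0 ^ (p - 1) := rpow_pos_of_pos (hapos n0) _
    obtain ⟨m, hm⟩ := pow_unbounded_of_one_lt (B * (2 ^ n0 * T0) / a n0 ^ (p - 1))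
      (show (1 : ℝ) < 2 by norm_num)
    refine ⟨2 ^ (n0 + m) * T0, h2n _, hapos _, le_trans ?_ (hgeo2 m)⟩
    rw [div_lt_iff₀ hA] at hm
    have : (4 : ℝ) ^ m = 2 ^ m * 2 ^ m := by rw [← mul_pow]; norm_num
    rw [this, pow_add]
    have h2 : (0 : ℝ) < 2 ^ m := by positivity
    nlinarith
  set r : ℝ := 2 ^ (-((p - 1) / (p + 1))) with hr
  have hr0 : 0 < r := by positivity
  have hr1 : r < 1 := by
    apply rpow_lt_one_of_one_lt_of_neg (by norm_num)
    have : 0 < (p - 1) / (p + 1) := by apply div_pos <;> linarith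
    linarith
  have hrp : r ^ (1 + p) = 2 ^ (-(p - 1)) := by
    rw [hr, ← rpow_mul (by norm_num)]
    congr 1
    have : p + 1 ≠ 0 := by linarith
    field_simp
    ring
  set ε := 1 - r with hε
  have hε0 : 0 < ε := by linarith
  obtain ⟨T, hT1, hST, hTB⟩ := hbig (2 / (δ * ε ^ (1 + p)))
  have hfin : ∀ j : ℕ, 2 ^ j * S T ≤ S (T + (1 - r ^ j)) := by
    intro j
    induction j with
    | zero => simp
    | succ j ih =>
      have hrj : 0 < r ^ j := by positivity
      have hrj1 : r ^ j ≤ 1 := pow_le_one₀ hr0.le hr1.le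
      set Tj := T + (1 - r ^ j) with hTj
      have hTj1 : 1 ≤ Tj := by linarith
      have h2j : 0 < 2 ^ j * S T := by positivity
      have hSj : 0 < S Tj := h2j.trans_le ih
      have h := hII Tj (ε * r ^ j) hTj1 (by positivity) (by nlinarith) hSj
      have e1 : Tj + ε * r ^ j = T + (1 - r ^ (j + 1)) := by rw [hTj, hε, pow_succ]; ring
      rw [e1] at h
      refine le_trans ?_ h
      have h8 : S Tj ≤ δ * (ε * r ^ j) ^ (1 + p) * S Tj ^ p / Tj := by
        have h3 : S Tj ^ p = S Tj ^ (p - 1) * S Tj := by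
          rw [← rpow_add_one hSj.ne']; simp
        have h4 : (2 ^ j * S T) ^ (p - 1) ≤ S Tj ^ (p - 1) :=
          rpow_le_rpow h2j.le ih hp0.le
        have h5 : (ε * r ^ j) ^ (1 + p) * (2 ^ j * S T) ^ (p - 1)
            = ε ^ (1 + p) * S T ^ (p - 1) := by
          rw [mul_rpow hε0.le hrj.le, mul_rpow (by positivity) hST.le]
          have e2 : (r ^ j) ^ (1 + p) = (2 ^ (-(p - 1)) : ℝ) ^ j := by
            rw [← hrp, ← rpow_natCast, ← rpow_natCast, ← rpow_mul hr0.le, ← rpow_mul hr0.le, mul_comm]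
          have e3 : ((2 : ℝ) ^ j) ^ (p - 1) = ((2 : ℝ) ^ (p - 1)) ^ j := by
            rw [← rpow_natCast, ← rpow_natCast, ← rpow_mul (by norm_num), ← rpow_mul (by norm_num), mul_comm]
          have e4 : (2 ^ (-(p - 1)) : ℝ) ^ j * ((2 : ℝ) ^ (p - 1)) ^ j = 1 := by
            rw [← mul_pow, ← rpow_add (by norm_num)]; simp
          rw [e2, e3]
          linear_combination (ε ^ (1 + p) * S T ^ (p - 1)) * e4
        have h6 : 2 * T ≤ δ * (ε ^ (1 + p) * S T ^ (p - 1)) := by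
          have hh : 0 < δ * ε ^ (1 + p) := by positivity
          have := mul_le_mul_of_nonneg_left hTB hh.le
          have e : δ * ε ^ (1 + p) * (2 / (δ * ε ^ (1 + p)) * T) = 2 * T := by field_simp
          rw [e] at this
          linarith
        have h7 : Tj ≤ 2 * T := by linarith
        rw [le_div_iff₀ (by linarith), h3]
        have h9 : Tj ≤ δ * (ε * r ^ j) ^ (1 + p) * S Tj ^ (p - 1) := by
          calc Tj ≤ δ * ((ε * r ^ j) ^ (1 + p) * (2 ^ j * S T) ^ (p - 1)) := by
                rw [h5]; linarith
            _ ≤ δ * ((ε * r ^ j) ^ (1 + p) * S Tj ^ (p - 1)) := by gcongr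
            _ = _ := by ring
        nlinarith
      rw [pow_succ]
      linarith
  obtain ⟨j, hj⟩ := pow_unbounded_of_one_lt (S (T + 1) / S T) (show (1 : ℝ) < 2 by norm_num)
  rw [div_lt_iff₀ hST] at hj
  have h1 := hfin j
  have hrj : 0 < r ^ j := by positivity
  have hrj1 : r ^ j ≤ 1 := pow_le_one₀ hr0.le hr1.le
  have h2 := hmono (T + (1 - r ^ j)) (T + 1) (by linarith) (by linarith)
  linarith
theorem no_global_weak_solution_memory_source_critical (N k : ℕ) (hN : 1 ≤ N) (hk : 1 ≤ k)
    (γ p1 p2 : ℝ) (hγ0 : 0 ≤ γ) (hγ1 : γ < 1) (hp1 : 1 < p1) (hp2 : 1 < p2)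
    (hpγ : p1 * γ ≤ 1)
    (u0 : Euc N × Euc k → ℝ) (hu0c : Continuous u0)
    (hu0z : Tendsto u0 (cocompact (Euc N × Euc k)) (nhds 0))
    (hu0nn : ∀ z, 0 ≤ u0 z) (hu0ne : ∃ z, u0 z ≠ 0) :
    ¬ ∃ u : Euc N × Euc k → ℝ → ℝ,
        (∀ z : Euc N × Euc k, ∀ t : ℝ, 0 ≤ t → 0 ≤ u z t) ∧
        (∃ U : ℝ → ZeroAtInftyContinuousMap (Euc N × Euc k) ℝ,
          ContinuousOn U (Set.Ici 0) ∧ ∀ t ∈ Set.Ici (0 : ℝ), ∀ z, U t z = u z t) ∧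
        (∀ T : ℝ, 0 < T → IsWeakSolutionGen N k 1 1 γ p1 p2 T u0 u) := by
  rintro ⟨u, hun, ⟨U, hUc, hU⟩, hw⟩
  obtain ⟨z₀, hz₀⟩ := hu0ne
  obtain ⟨l, hl0, hl⟩ := gpsi_bound z₀
  set v : Euc N × Euc k → ℝ → ℝ := fun z t => u z (max t 0) with hvdef
  have hvpos : ∀ z t, 0 < t → v z t = u z t := by
    intro z t ht
    simp only [hvdef, max_eq_left ht.le]
  have hv0 : ∀ z t, 0 ≤ v z t := fun z t => hun z _ (le_max_right _ _)
  have hv : Continuous fun q : (Euc N × Euc k) × ℝ => v q.1 q.2 := by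
    have h1 : Continuous fun t : ℝ => (U (max t 0)).toBCF :=
      ZeroAtInftyContinuousMap.isometry_toBCF.continuous.comp
        (hUc.comp_continuous (by fun_prop) (fun t => Set.mem_Ici.2 (le_max_right _ _)))
    have h2 : Continuous fun q : (Euc N × Euc k) × ℝ => (U (max q.2 0)).toBCF q.1 :=
      (h1.comp continuous_snd).eval continuous_fst
    refine h2.congr fun q => ?_
    exact hU _ (Set.mem_Ici.2 (le_max_right _ _)) q.1
  have hfr : ∀ z t, fracInt (1 - γ) (fun s => absPow p1 (v z s)) t =
      fracInt (1 - γ) (fun s => absPow p1 (u z s)) t := by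
    intro z t
    unfold fracInt
    congr 1
    refine setIntegral_congr_fun measurableSet_Ioc fun s hs => ?_
    simp only [hvpos z s hs.1]
  have hwv : ∀ T : ℝ, 0 < T → IsWeakSolutionGen N k 1 1 γ p1 p2 T u0 v := by
    intro T hT
    obtain ⟨a1, -, a3⟩ := hw T hT
    refine ⟨?_, ?_, ?_⟩
    · simp only [hfr]
      exact a1
    · exact ((continuous_absPow hp2).comp hv).locallyIntegrable.locallyIntegrableOn _
    · intro φ h1 h2 h3
      have h4 := a3 φ h1 h2 h3
      simp only [hfr, hvpos _ T hT]
      rw [h4]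
      congr 1
      · congr 1
        · congr 2
          refine setIntegral_congr_fun measurableSet_Ioc fun s hs => ?_
          simp only [hvpos _ s hs.1]
        · refine setIntegral_congr_fun measurableSet_Ioc fun s hs => ?_
          simp only [hvpos _ s hs.1]
      · refine setIntegral_congr_fun measurableSet_Ioc fun s hs => ?_
        simp only [hvpos _ s hs.1]
  have hF0 : 0 < ∫ z, u0 z * psi z₀ z := by
    refine Continuous.integral_pos_of_hasCompactSupport_nonneg_nonzero (x := z₀)
      (hu0c.mul (continuous_psi z₀)) (HasCompactSupport.intro (isCompact_Kset z₀) ?_)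
      (fun z => mul_nonneg (hu0nn z) (psi_nonneg z₀ z)) ?_
    · intro z hz
      simp [psi_zero z₀ z hz]
    · simpa [psi_self z₀] using hz₀
  have hstart := start_pos z₀ γ p1 p2 hγ1 hp1 u0 hF0 v hv hv0 hwv l hl0 hl
  have hQc := continuous_Qf p1 hp1 z₀ v hv
  have hQ0 := Qf_nonneg p1 z₀ v hv0
  set P := ∫ z, psi z₀ z with hP
  have hP0 : 0 ≤ P := integral_nonneg fun z => psi_nonneg z₀ z
  have hB := bump_integral_pos
  refine ode_blowup (fun t => ∫ s in (0 : ℝ)..t, Qf p1 z₀ v s) γ p1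
    ((2 : ℝ) ^ (-γ) * ∫ s, bump s) ((l + 3) * (1 + P)) (by positivity) (by positivity)
    hp1 hpγ ?_ ⟨2, by norm_num, hstart⟩ ?_
  · intro s t hs hst
    exact intervalIntegral.integral_mono_interval le_rfl hs hst
      (Eventually.of_forall hQ0) (hQc.intervalIntegrable _ _)
  · intro T τ M hT hτ hτT hM
    have hT0 : 0 < T := by linarith
    have h := key_ineq z₀ γ p1 p2 hγ0 hγ1 hp1 u0 v hv hv0 hwv l hl0 hl T τ M hT0 hτ hτT hM
    have e : (∫ s in (0 : ℝ)..(T + τ), Qf p1 z₀ v s) - (∫ s in (0 : ℝ)..T, Qf p1 z₀ v s) =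
        ∫ s in T..(T + τ), Qf p1 z₀ v s :=
      intervalIntegral.integral_interval_sub_left (hQc.intervalIntegrable _ _)
        (hQc.intervalIntegrable _ _)
    show _ * τ * T ^ (-γ) * (∫ s in (0 : ℝ)..T, Qf p1 z₀ v s) ≤ _ * (_ *
      ((∫ s in (0 : ℝ)..(T + τ), Qf p1 z₀ v s) - (∫ s in (0 : ℝ)..T, Qf p1 z₀ v s)) + _)
    rw [e]
    rw [mul_rpow (by norm_num) hT0.le] at h
    have hD : 0 ≤ ∫ s in T..(T + τ), Qf p1 z₀ v s :=
      intervalIntegral.integral_nonneg (by linarith) fun s _ => hQ0 s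
    set D := ∫ s in T..(T + τ), Qf p1 z₀ v s
    set S := ∫ s in (0 : ℝ)..T, Qf p1 z₀ v s
    have hMD : 0 ≤ M ^ (1 - p1) * D := by positivity
    have b1 : l + 3 / τ ≤ (l + 3) * (1 + 1 / τ) := by
      have : 0 ≤ 1 / τ := by positivity
      have e3 : 3 / τ = 3 * (1 / τ) := by ring
      rw [e3]
      nlinarith
    have b2 : M ^ (1 - p1) * D + M * P * τ ≤ (1 + P) * (M ^ (1 - p1) * D + M * τ) := by
      have : 0 ≤ M * τ := by positivity
      nlinarith
    calc (2 : ℝ) ^ (-γ) * (∫ s, bump s) * τ * T ^ (-γ) * S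
        = 2 ^ (-γ) * T ^ (-γ) * S * (τ * ∫ s, bump s) := by ring
      _ ≤ (l + 3 / τ) * (M ^ (1 - p1) * D + M * P * τ) := h
      _ ≤ ((l + 3) * (1 + 1 / τ)) * ((1 + P) * (M ^ (1 - p1) * D + M * τ)) := by
        refine mul_le_mul b1 b2 (by positivity) (by positivity)
      _ = _ := by ring
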